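/- Let ξ, η, ξ', η' ∈ C_c((0,∞)) and let (b₀, a₀) ∈ ℝ × (0,∞). Then ∫₀^∞ ∫_ℝ (ξ *₊ η)((b − b₀)/a₀, a/a₀) · conj((ξ' *₊ η')(b,a)) db a⁻² da = (∫₀^∞ ξ(t) conj(ξ'(t)) t⁻² dt) · (∫₀^∞ e^{2πi b₀ t} conj(η(a₀ t)) η'(t) t⁻¹ dt). That is, the left translate of a coefficient function of π₊ pairs in L²(G) against coefficient functions of π₊ to give (a scalar multiple of) a coefficient function of π₋ evaluated at the group element. -/

import Mathlib

open MeasureTheory Set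

/-- Coefficient function of the representation `π₊` of the real `ax+b` group:
`(ξ *₊ η)(b,a) = ∫₀^∞ e^{-2πibt} ξ(at) conj(η(t)) t⁻¹ dt`. -/
noncomputable def coeffP (ξ η : ℝ → ℂ) (b a : ℝ) : ℂ :=
  ∫ t in Ioi (0 : ℝ),
    Complex.exp (-(2 * Real.pi * b * t : ℝ) * Complex.I) * ξ (a * t)
      * starRingEnd ℂ (η t) * (t : ℂ)⁻¹

/-- Coefficient function of the representation `π₋` of the real `ax+b` group:
`(ξ *₋ η)(b,a) = ∫₀^∞ e^{2πibt} ξ(at) conj(η(t)) t⁻¹ dt`. -/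
noncomputable def coeffM (ξ η : ℝ → ℂ) (b a : ℝ) : ℂ :=
  ∫ t in Ioi (0 : ℝ),
    Complex.exp ((2 * Real.pi * b * t : ℝ) * Complex.I) * ξ (a * t)
      * starRingEnd ℂ (η t) * (t : ℂ)⁻¹

/-- `C_c²((0,∞))`: twice continuously differentiable complex-valued functions on `ℝ`
with compact support contained in `(0,∞)`. -/
def CcTwo (f : ℝ → ℂ) : Prop :=
  ContDiff ℝ 2 f ∧ HasCompactSupport f ∧ tsupport f ⊆ Ioi (0 : ℝ)

/-- Left Haar measure `a⁻² db da` of the `ax+b` group, modelled on `ℝ × (0,∞)`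
(first coordinate `b`, second coordinate `a`). -/
noncomputable def muG : Measure (ℝ × ℝ) :=
  (((volume : Measure ℝ).prod ((volume : Measure ℝ).restrict (Ioi (0 : ℝ)))).withDensity
    fun p => ENNReal.ofReal ((p.2 ^ 2)⁻¹))

/-- `C_c((0,∞))`: continuous complex-valued functions on `ℝ` with compact support
contained in `(0,∞)`. -/
def CcZero (f : ℝ → ℂ) : Prop :=
  Continuous f ∧ HasCompactSupport f ∧ tsupport f ⊆ Ioi (0 : ℝ)

open scoped FourierTransform

/-- The `L²` Fourier transform of an integrable function is its Fourier integral. -/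
theorem coeFn_fourier_toLp {g : ℝ → ℂ} (hg : Integrable g) (hg₂ : MemLp g 2) :
    (𝓕 (hg₂.toLp g) : Lp ℂ 2 (volume : Measure ℝ)) =ᵐ[volume] 𝓕 g := by
  have hcont : Continuous (𝓕 g) :=
    VectorFourier.fourierIntegral_continuous Real.continuous_fourierChar
      (by exact continuous_inner) hg
  refine ae_eq_of_integral_contDiff_smul_eq
    ((Lp.memLp _).locallyIntegrable (by norm_num)) hcont.locallyIntegrable fun φ hφ hφs => ?_
  have hφs' : HasCompactSupport (fun x => (φ x : ℂ)) := hφs.comp_left Complex.ofReal_zero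
  let ψ : SchwartzMap ℝ ℂ := hφs'.toSchwartzMap (Complex.ofRealCLM.contDiff.comp hφ)
  have hψφ (x : ℝ) : ψ x = φ x := rfl
  have h := congrArg (fun T => T ψ) (Lp.fourier_toTemperedDistribution_eq (hg₂.toLp g))
  simp only [TemperedDistribution.fourier_apply, Lp.toTemperedDistribution_apply, hψφ] at h
  calc ∫ x, φ x • (𝓕 (hg₂.toLp g) : Lp ℂ 2 (volume : Measure ℝ)) x
      = ∫ x, (φ x : ℂ) • (𝓕 (hg₂.toLp g) : Lp ℂ 2 (volume : Measure ℝ)) x := by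
        simp
    _ = ∫ x, (𝓕 ψ) x • g x := by
        rw [← h]
        refine integral_congr_ae ?_
        filter_upwards [hg₂.coeFn_toLp] with x hx
        rw [hx]
    _ = ∫ x, ψ x • 𝓕 g x := by
        have := VectorFourier.integral_fourierIntegral_smul_eq_flip (μ := volume) (ν := volume)
          (L := innerₗ ℝ) (f := ψ) (g := g) Real.continuous_fourierChar
          (by exact continuous_inner) ψ.integrable hg
        rw [flip_innerₗ] at this
        exact this
    _ = ∫ x, φ x • 𝓕 g x := by
        simp [hψφ]

theorem memLp_two_fourier {g : ℝ → ℂ} (hg : Integrable g) (hg₂ : MemLp g 2) :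
    MemLp (𝓕 g) 2 :=
  (memLp_congr_ae (coeFn_fourier_toLp hg hg₂)).1 (Lp.memLp _)

/-- Plancherel's theorem for functions in `L¹ ∩ L²`. -/
theorem integral_fourier_mul_conj_fourier {g h : ℝ → ℂ} (hg : Integrable g) (hg₂ : MemLp g 2)
    (hh : Integrable h) (hh₂ : MemLp h 2) :
    ∫ b, 𝓕 g b * starRingEnd ℂ (𝓕 h b) = ∫ s, g s * starRingEnd ℂ (h s) := by
  have key := Lp.inner_fourier_eq (hh₂.toLp h) (hg₂.toLp g)
  simp only [L2.inner_def] at key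
  calc ∫ b, 𝓕 g b * starRingEnd ℂ (𝓕 h b)
      = ∫ b, inner ℂ ((𝓕 (hh₂.toLp h) : Lp ℂ 2 (volume : Measure ℝ)) b)
          ((𝓕 (hg₂.toLp g) : Lp ℂ 2 (volume : Measure ℝ)) b) := by
        refine integral_congr_ae ?_
        filter_upwards [coeFn_fourier_toLp hg hg₂, coeFn_fourier_toLp hh hh₂] with b h₁ h₂
        rw [h₁, h₂]
        rfl
    _ = _ := key
    _ = ∫ s, g s * starRingEnd ℂ (h s) := by
        refine integral_congr_ae ?_
        filter_upwards [hg₂.coeFn_toLp, hh₂.coeFn_toLp] with b h₁ h₂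
        rw [h₁, h₂]
        rfl

theorem setIntegral_Ioi_comp_mul_right (F : ℝ → ℂ) {s : ℝ} (hs : 0 < s) :
    ∫ a in Ioi (0 : ℝ), F (a * s) = (∫ t in Ioi (0 : ℝ), F t) * (s : ℂ)⁻¹ := by
  rw [integral_comp_mul_right_Ioi F 0 hs, zero_mul, Complex.real_smul, mul_comm,
    Complex.ofReal_inv]

theorem integrable_muG_iff {f : ℝ × ℝ → ℂ} :
    Integrable f muG ↔ Integrable (fun p => f p * ((p.2 : ℂ) ^ 2)⁻¹)
      ((volume : Measure ℝ).prod (volume.restrict (Ioi (0 : ℝ)))) := by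
  rw [muG, integrable_withDensity_iff_integrable_smul' (by fun_prop) (by simp)]
  refine integrable_congr (.of_forall fun p => ?_)
  simp only [ENNReal.toReal_ofReal (inv_nonneg.2 (sq_nonneg p.2)), Complex.real_smul]
  push_cast
  ring

theorem integral_muG (f : ℝ × ℝ → ℂ) :
    ∫ p, f p ∂muG = ∫ p, f p * ((p.2 : ℂ) ^ 2)⁻¹
      ∂((volume : Measure ℝ).prod (volume.restrict (Ioi (0 : ℝ)))) := by
  rw [muG, integral_withDensity_eq_integral_toReal_smul (by fun_prop) (by simp)]
  refine integral_congr_ae (.of_forall fun p => ?_)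
  simp only [ENNReal.toReal_ofReal (inv_nonneg.2 (sq_nonneg p.2)), Complex.real_smul]
  push_cast
  ring

namespace CcZero

variable {f g F K ξ κ ξ' κ' : ℝ → ℂ}

theorem eq_zero (hf : CcZero f) {t : ℝ} (ht : t ≤ 0) : f t = 0 :=
  image_eq_zero_of_notMem_tsupport fun h => not_lt.2 ht (hf.2.2 h)

theorem integrable (hf : CcZero f) : Integrable f :=
  hf.1.integrable_of_hasCompactSupport hf.2.1

theorem memLp_two (hf : CcZero f) : MemLp f 2 :=
  hf.1.memLp_of_hasCompactSupport hf.2.1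

theorem mul_continuousOn (hf : CcZero f) {h : ℝ → ℂ} (hh : ContinuousOn h (Ioi 0)) :
    CcZero fun t => f t * h t := by
  have hsub : tsupport (fun t => f t * h t) ⊆ tsupport f := tsupport_mul_subset_left
  refine ⟨continuous_of_tsupport fun t ht => ?_, hf.2.1.mul_right, hsub.trans hf.2.2⟩
  exact hf.1.continuousAt.mul (hh.continuousAt (Ioi_mem_nhds (hf.2.2 (hsub ht))))

theorem conj (hf : CcZero f) : CcZero fun t => starRingEnd ℂ (f t) := by
  have hsub : tsupport (fun t => starRingEnd ℂ (f t)) ⊆ tsupport f :=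
    closure_mono (Function.support_comp_subset (map_zero (starRingEnd ℂ)) f)
  exact ⟨Complex.continuous_conj.comp hf.1, hf.2.1.comp_left (map_zero (starRingEnd ℂ)),
    hsub.trans hf.2.2⟩

theorem comp_mul_left (hf : CcZero f) {c : ℝ} (hc : 0 < c) : CcZero fun t => f (c * t) := by
  have hsub : tsupport (fun t => f (c * t)) ⊆ (c * ·) ⁻¹' tsupport f :=
    tsupport_comp_subset_preimage f (continuous_const_mul c)
  refine ⟨hf.1.comp (continuous_const_mul c), ?_, fun t ht => ?_⟩
  · exact hf.2.1.comp_homeomorph (Homeomorph.mulLeft₀ c hc.ne')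
  · exact pos_of_mul_pos_right (hf.2.2 (hsub ht)) hc.le

theorem comp_mul_right_mul (hF : CcZero F) (hK : CcZero K) (a : ℝ) :
    CcZero fun s => F (a * s) * K s := by
  have h := hK.mul_continuousOn (h := fun s => F (a * s))
    (hF.1.comp (continuous_const_mul a)).continuousOn
  simpa only [mul_comm] using h

theorem mul_conj_mul_inv_sq (hf : CcZero f) (hg : CcZero g) :
    CcZero fun t => f t * starRingEnd ℂ (g t) * ((t : ℂ) ^ 2)⁻¹ := by
  refine (hf.mul_continuousOn hg.conj.1.continuousOn).mul_continuousOn ?_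
  refine ContinuousOn.inv₀ (by fun_prop) fun t ht => ?_
  exact pow_ne_zero 2 (Complex.ofReal_ne_zero.2 (ne_of_gt ht))

theorem mul_conj_mul_sq (hf : CcZero f) (hg : CcZero g) :
    CcZero fun t => f t * starRingEnd ℂ (g t) * (t : ℂ) ^ 2 :=
  (hf.mul_continuousOn hg.conj.1.continuousOn).mul_continuousOn (by fun_prop)

theorem integrable_prod (hF : CcZero F) (hK : CcZero K) :
    Integrable (fun p : ℝ × ℝ => F (p.2 * p.1) * K p.1)
      ((volume : Measure ℝ).prod (volume.restrict (Ioi (0 : ℝ)))) := by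
  have hcont : Continuous fun p : ℝ × ℝ => F (p.2 * p.1) * K p.1 :=
    (hF.1.comp (continuous_snd.mul continuous_fst)).mul (hK.1.comp continuous_fst)
  refine (integrable_prod_iff hcont.aestronglyMeasurable).2 ⟨.of_forall fun s => ?_, ?_⟩
  · rcases le_or_gt s 0 with hs | hs
    · simp [hK.eq_zero hs]
    · have h := (integrableOn_Ioi_comp_mul_right_iff F 0 hs).2
        (by simpa using hF.integrable.integrableOn)
      exact Integrable.mul_const h (K s)
  · have hKs : CcZero fun s => K s * (s : ℂ)⁻¹ :=
      hK.mul_continuousOn <| ContinuousOn.inv₀ (by fun_prop) fun t ht =>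
        Complex.ofReal_ne_zero.2 (ne_of_gt ht)
    refine (hKs.integrable.norm.const_mul (∫ t in Ioi (0 : ℝ), ‖F t‖)).congr
      (.of_forall fun s => ?_)
    rcases le_or_gt s 0 with hs | hs
    · simp [hK.eq_zero hs]
    · have := integral_comp_mul_right_Ioi (fun t => ‖F t‖) 0 hs
      simp only [zero_mul, smul_eq_mul] at this
      simp only [norm_mul, integral_mul_const, this, norm_inv, Complex.norm_real,
        Real.norm_of_nonneg hs.le]
      ring

theorem integral_integral_comp_mul (hF : CcZero F) (hK : CcZero K) :
    ∫ a in Ioi (0 : ℝ), ∫ s, F (a * s) * K s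
      = (∫ t in Ioi (0 : ℝ), F t) * ∫ s in Ioi (0 : ℝ), K s * (s : ℂ)⁻¹ := by
  have hswap := integral_integral_swap (f := fun s a => F (a * s) * K s)
    (μ := volume) (ν := volume.restrict (Ioi (0 : ℝ))) (hF.integrable_prod hK)
  rw [← hswap, ← integral_const_mul]
  rw [← setIntegral_eq_integral_of_forall_compl_eq_zero (s := Ioi (0 : ℝ))
    fun s hs => by simp [hK.eq_zero (not_lt.1 hs)]]
  refine setIntegral_congr_fun measurableSet_Ioi fun s hs => ?_
  simp only [integral_mul_const, setIntegral_Ioi_comp_mul_right F hs]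
  ring

theorem stronglyMeasurable_fourier (hξ : CcZero ξ) (hκ : CcZero κ) :
    StronglyMeasurable fun p : ℝ × ℝ => 𝓕 (fun s => ξ (p.2 * s) * κ s) p.1 := by
  simp only [Real.fourier_real_eq_integral_exp_smul]
  have hcont : Continuous fun q : (ℝ × ℝ) × ℝ =>
      Complex.exp (↑(-2 * Real.pi * q.2 * q.1.1) * Complex.I) • (ξ (q.1.2 * q.2) * κ q.2) := by
    have h₁ := hξ.1
    have h₂ := hκ.1
    fun_prop
  exact hcont.stronglyMeasurable.integral_prod_right

theorem fiber_integral (hξ : CcZero ξ) (hκ : CcZero κ) (hξ' : CcZero ξ') (hκ' : CcZero κ')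
    (a : ℝ) :
    ∫ b, 𝓕 (fun s => ξ (a * s) * κ s) b * starRingEnd ℂ (𝓕 (fun s => ξ' (a * s) * κ' s) b)
        * ((a : ℂ) ^ 2)⁻¹
      = ∫ s, (ξ (a * s) * starRingEnd ℂ (ξ' (a * s)) * (((a * s : ℝ) : ℂ) ^ 2)⁻¹)
          * (κ s * starRingEnd ℂ (κ' s) * (s : ℂ) ^ 2) := by
  have h := hξ.comp_mul_right_mul hκ a
  have h' := hξ'.comp_mul_right_mul hκ' a
  rw [integral_mul_const, integral_fourier_mul_conj_fourier h.integrable h.memLp_two h'.integrable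
    h'.memLp_two, ← integral_mul_const]
  refine integral_congr_ae (.of_forall fun s => ?_)
  rcases le_or_gt s 0 with hs | hs
  · simp [hκ.eq_zero hs]
  · have hs' : (s : ℂ) ≠ 0 := Complex.ofReal_ne_zero.2 hs.ne'
    simp only [map_mul, Complex.ofReal_mul, mul_pow, mul_inv]
    field_simp

theorem integrable_sq_norm_fourier (hξ : CcZero ξ) (hκ : CcZero κ) :
    Integrable (fun p : ℝ × ℝ => 𝓕 (fun s => ξ (p.2 * s) * κ s) p.1
        * starRingEnd ℂ (𝓕 (fun s => ξ (p.2 * s) * κ s) p.1) * ((p.2 : ℂ) ^ 2)⁻¹)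
      ((volume : Measure ℝ).prod (volume.restrict (Ioi (0 : ℝ)))) := by
  have hm := (hξ.stronglyMeasurable_fourier hκ).measurable
  have hmeas : Measurable fun p : ℝ × ℝ => 𝓕 (fun s => ξ (p.2 * s) * κ s) p.1
        * starRingEnd ℂ (𝓕 (fun s => ξ (p.2 * s) * κ s) p.1) * ((p.2 : ℂ) ^ 2)⁻¹ :=
    (hm.mul (Complex.continuous_conj.measurable.comp hm)).mul (by fun_prop)
  refine (integrable_prod_iff' hmeas.aestronglyMeasurable).2 ⟨.of_forall fun a => ?_, ?_⟩
  · have h := hξ.comp_mul_right_mul hκ a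
    have h₂ := memLp_two_fourier h.integrable h.memLp_two
    exact (h₂.integrable_mul h₂.star).mul_const (((a : ℂ) ^ 2)⁻¹)
  · refine (((hξ.mul_conj_mul_inv_sq hξ).integrable_prod
      (hκ.mul_conj_mul_sq hκ)).integral_prod_right).norm.congr (.of_forall fun a => ?_)
    simp only
    rw [← hξ.fiber_integral hκ hξ hκ a]
    have hpt (b : ℝ) : 𝓕 (fun s => ξ (a * s) * κ s) b
        * starRingEnd ℂ (𝓕 (fun s => ξ (a * s) * κ s) b) * ((a : ℂ) ^ 2)⁻¹
        = ((‖𝓕 (fun s => ξ (a * s) * κ s) b * starRingEnd ℂ (𝓕 (fun s => ξ (a * s) * κ s) b)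
          * ((a : ℂ) ^ 2)⁻¹‖ : ℝ) : ℂ) := by
      simp [Complex.mul_conj, Complex.normSq_eq_norm_sq, ← Complex.ofReal_pow]
    rw [integral_congr_ae (.of_forall hpt), integral_complex_ofReal, Complex.norm_real,
      Real.norm_of_nonneg (integral_nonneg fun _ => norm_nonneg _)]

theorem memLp_fourier_muG (hξ : CcZero ξ) (hκ : CcZero κ) :
    MemLp (fun p : ℝ × ℝ => 𝓕 (fun s => ξ (p.2 * s) * κ s) p.1) 2 muG := by
  refine (memLp_two_iff_integrable_sq_norm
    (hξ.stronglyMeasurable_fourier hκ).aestronglyMeasurable).2 ?_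
  refine (integrable_muG_iff.2 (hξ.integrable_sq_norm_fourier hκ)).norm.congr
    (.of_forall fun p => ?_)
  simp [sq]

/-- Orthogonality relations for the coefficient functions of `π₊`. -/
theorem integral_fourier_muG (hξ : CcZero ξ) (hκ : CcZero κ) (hξ' : CcZero ξ')
    (hκ' : CcZero κ') :
    Integrable (fun p : ℝ × ℝ => 𝓕 (fun s => ξ (p.2 * s) * κ s) p.1
        * starRingEnd ℂ (𝓕 (fun s => ξ' (p.2 * s) * κ' s) p.1)) muG ∧
    ∫ p : ℝ × ℝ, 𝓕 (fun s => ξ (p.2 * s) * κ s) p.1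
        * starRingEnd ℂ (𝓕 (fun s => ξ' (p.2 * s) * κ' s) p.1) ∂muG
      = (∫ t in Ioi (0 : ℝ), ξ t * starRingEnd ℂ (ξ' t) * ((t : ℂ) ^ 2)⁻¹) *
        ∫ s in Ioi (0 : ℝ), κ s * starRingEnd ℂ (κ' s) * (s : ℂ) ^ 2 * (s : ℂ)⁻¹ := by
  have hint : Integrable (fun p : ℝ × ℝ => 𝓕 (fun s => ξ (p.2 * s) * κ s) p.1
      * starRingEnd ℂ (𝓕 (fun s => ξ' (p.2 * s) * κ' s) p.1)) muG :=
    (hξ.memLp_fourier_muG hκ).integrable_mul (hξ'.memLp_fourier_muG hκ').star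
  refine ⟨hint, ?_⟩
  rw [integral_muG, integral_prod_symm _ (integrable_muG_iff.1 hint)]
  simp only [hξ.fiber_integral hκ hξ' hκ']
  exact (hξ.mul_conj_mul_inv_sq hξ').integral_integral_comp_mul (hκ.mul_conj_mul_sq hκ')

theorem conj_mul_inv (hf : CcZero f) : CcZero fun s => starRingEnd ℂ (f s) * (s : ℂ)⁻¹ :=
  hf.conj.mul_continuousOn <| ContinuousOn.inv₀ (by fun_prop) fun _ ht =>
    Complex.ofReal_ne_zero.2 (ne_of_gt ht)

end CcZero

theorem coeffP_eq_fourier {ξ η : ℝ → ℂ} (hη : CcZero η) (b a : ℝ) :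
    coeffP ξ η b a = 𝓕 (fun s => ξ (a * s) * (starRingEnd ℂ (η s) * (s : ℂ)⁻¹)) b := by
  rw [coeffP, setIntegral_eq_integral_of_forall_compl_eq_zero
    fun t ht => by simp [hη.eq_zero (not_lt.1 ht)], Real.fourier_real_eq_integral_exp_smul]
  refine integral_congr_ae (.of_forall fun s => ?_)
  simp only [smul_eq_mul, ← mul_assoc]
  congr 4
  push_cast
  ring

theorem coeffP_translate_eq_fourier {ξ η : ℝ → ℂ} (hη : CcZero η) (b₀ : ℝ) {a₀ : ℝ}
    (ha₀ : 0 < a₀) (b a : ℝ) :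
    coeffP ξ η ((b - b₀) / a₀) (a / a₀)
      = 𝓕 (fun s => ξ (a * s) * (starRingEnd ℂ (η (a₀ * s)) * (s : ℂ)⁻¹
          * Complex.exp ((2 * Real.pi * b₀ * s : ℝ) * Complex.I))) b := by
  have hsub := integral_comp_mul_left_Ioi (fun t : ℝ =>
    Complex.exp (-(2 * Real.pi * ((b - b₀) / a₀) * t : ℝ) * Complex.I) * ξ (a / a₀ * t)
      * starRingEnd ℂ (η t) * (t : ℂ)⁻¹) 0 ha₀
  rw [mul_zero] at hsub
  have ha₀' : (a₀ : ℂ) ≠ 0 := Complex.ofReal_ne_zero.2 ha₀.ne'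
  rw [coeffP, ← one_smul ℝ (integral _ _), ← mul_inv_cancel₀ ha₀.ne', mul_smul, ← hsub,
    Complex.real_smul, ← integral_const_mul, setIntegral_eq_integral_of_forall_compl_eq_zero
    fun t ht => by simp [(hη.comp_mul_left ha₀).eq_zero (not_lt.1 ht)],
    Real.fourier_real_eq_integral_exp_smul]
  refine integral_congr_ae (.of_forall fun s => ?_)
  have harg : a / a₀ * (a₀ * s) = a * s := by field_simp
  have hexp : Complex.exp (-(2 * Real.pi * ((b - b₀) / a₀) * (a₀ * s) : ℝ) * Complex.I)
      = Complex.exp ((-2 * Real.pi * s * b : ℝ) * Complex.I)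
        * Complex.exp ((2 * Real.pi * b₀ * s : ℝ) * Complex.I) := by
    rw [← Complex.exp_add]
    congr 1
    push_cast
    field_simp
    ring
  simp only [harg, hexp, smul_eq_mul, Complex.ofReal_mul a₀ s, mul_inv]
  field_simp

/-- Step 2 in the appendix of Choi–Ghandehari: pairing the left translate by
`(b₀,a₀)` of a coefficient function of `π₊` against a coefficient function of `π₊`
in `L²(G)` produces a multiple of a coefficient function of `π₋` evaluated at
`(b₀,a₀)`.  Here the left translate of `f` is `(b,a) ↦ f((b−b₀)/a₀, a/a₀)`, and the
left Haar measure is `a⁻² db da`. -/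
theorem translate_pairing (ξ η ξ' η' : ℝ → ℂ)
    (hξ : CcZero ξ) (hη : CcZero η) (hξ' : CcZero ξ') (hη' : CcZero η')
    (b₀ a₀ : ℝ) (ha₀ : 0 < a₀) :
    Integrable (fun p : ℝ × ℝ =>
      coeffP ξ η ((p.1 - b₀) / a₀) (p.2 / a₀)
        * starRingEnd ℂ (coeffP ξ' η' p.1 p.2)) muG ∧
    ∫ p, coeffP ξ η ((p.1 - b₀) / a₀) (p.2 / a₀)
        * starRingEnd ℂ (coeffP ξ' η' p.1 p.2) ∂muG
      = (∫ t in Ioi (0 : ℝ), ξ t * starRingEnd ℂ (ξ' t) * ((t : ℂ) ^ 2)⁻¹) *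
        (∫ t in Ioi (0 : ℝ),
          Complex.exp ((2 * Real.pi * b₀ * t : ℝ) * Complex.I)
            * starRingEnd ℂ (η (a₀ * t)) * η' t * (t : ℂ)⁻¹) := by
  have hκ : CcZero fun s => starRingEnd ℂ (η (a₀ * s)) * (s : ℂ)⁻¹
      * Complex.exp ((2 * Real.pi * b₀ * s : ℝ) * Complex.I) :=
    (hη.comp_mul_left ha₀).conj_mul_inv.mul_continuousOn (by fun_prop)
  have hmain := hξ.integral_fourier_muG hκ hξ' hη'.conj_mul_inv
  simp only [← coeffP_translate_eq_fourier hη b₀ ha₀, ← coeffP_eq_fourier hη'] at hmain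
  refine ⟨hmain.1, hmain.2.trans (congrArg _ ?_)⟩
  refine setIntegral_congr_fun measurableSet_Ioi fun s hs => ?_
  have hs' : (s : ℂ) ≠ 0 := Complex.ofReal_ne_zero.2 (ne_of_gt hs)
  simp only [map_mul, map_inv₀, Complex.conj_ofReal, Complex.conj_conj]
  field_simp
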